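/- Let $u_0$ be an analytic stationary solution of $u_t = bx^\gamma u_{xx} + f(x)u_x$ with $\gamma \ne 2$, $b > 0$, and suppose $h(x) = x^{1-\gamma}f(x)$ solves the Riccati equation $bxh' - bh + \tfrac12 h^2 = 2bAx^{2-\gamma} + B$. Define $\overline{U}_\varepsilon(x,t) = (1+4\varepsilon t)^{-(1-\gamma)/(2-\gamma)} \exp\{\tfrac{-4\varepsilon(x^{2-\gamma} + Ab(2-\gamma)^2 t^2)}{b(2-\gamma)^2(1+4\varepsilon t)}\} \exp\{\tfrac{1}{2b}(F(x(1+4\varepsilon t)^{-2/(2-\gamma)}) - F(x))\}\, u_0(x(1+4\varepsilon t)^{-2/(2-\gamma)})$, where $F' = f(x)/x^\gamma$. Then for $\varepsilon$ sufficiently small, $\overline{U}_\varepsilon$ is again a solution of the PDE. -/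

import Mathlib

open Real Set

noncomputable section

/-- Lie point symmetry of `u_t = b x^γ u_xx + f(x) u_x` (Craddock–Lennox,
Theorem 3.1, specialized to `g = 0`). If `u₀` is an analytic stationary solution and
`h(x) = x^{1-γ} f(x)` solves the Riccati equation
`b x h' - b h + h²/2 = 2bA x^{2-γ} + B`, then for `ε` sufficiently small
(precisely: whenever `1 + 4εt > 0`), the function
`Ū_ε(x,t) = (1+4εt)^{-(1-γ)/(2-γ)}
  exp{-4ε(x^{2-γ} + Ab(2-γ)²t²) / (b(2-γ)²(1+4εt))}
  exp{(F(x(1+4εt)^{-2/(2-γ)}) - F(x))/(2b)} u₀(x(1+4εt)^{-2/(2-γ)})`,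
with `F' = f(x)/x^γ`, again solves the PDE. -/
theorem lie_symmetry_riccati_case_one
    (b γ A B : ℝ) (hb : 0 < b) (hγ : γ ≠ 2)
    (f F u₀ : ℝ → ℝ)
    (hf : ContDiffOn ℝ 1 f (Ioi 0))
    (hF : ∀ x : ℝ, 0 < x → HasDerivAt F (f x / x ^ γ) x)
    (hu₀_analytic : ∀ x : ℝ, 0 < x → AnalyticAt ℝ u₀ x)
    (hstationary : ∀ x : ℝ, 0 < x →
      b * x ^ γ * iteratedDeriv 2 u₀ x + f x * deriv u₀ x = 0)
    (hriccati : ∀ x : ℝ, 0 < x →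
      b * x * deriv (fun y => y ^ (1 - γ) * f y) x - b * (x ^ (1 - γ) * f x)
          + (x ^ (1 - γ) * f x) ^ 2 / 2
        = 2 * b * A * x ^ (2 - γ) + B) :
    ∀ ε x t : ℝ, 0 < x → 0 ≤ t → 0 < 1 + 4 * ε * t →
      deriv (fun τ =>
          (1 + 4 * ε * τ) ^ (-((1 - γ) / (2 - γ))) *
            Real.exp (-4 * ε * (x ^ (2 - γ) + A * b * (2 - γ) ^ 2 * τ ^ 2)
                / (b * (2 - γ) ^ 2 * (1 + 4 * ε * τ))) *
            Real.exp (1 / (2 * b) *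
              (F (x * (1 + 4 * ε * τ) ^ (-(2 / (2 - γ)))) - F x)) *
            u₀ (x * (1 + 4 * ε * τ) ^ (-(2 / (2 - γ))))) t
        = b * x ^ γ * iteratedDeriv 2 (fun y =>
            (1 + 4 * ε * t) ^ (-((1 - γ) / (2 - γ))) *
              Real.exp (-4 * ε * (y ^ (2 - γ) + A * b * (2 - γ) ^ 2 * t ^ 2)
                  / (b * (2 - γ) ^ 2 * (1 + 4 * ε * t))) *
              Real.exp (1 / (2 * b) *
                (F (y * (1 + 4 * ε * t) ^ (-(2 / (2 - γ)))) - F y)) *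
              u₀ (y * (1 + 4 * ε * t) ^ (-(2 / (2 - γ))))) x
          + f x * deriv (fun y =>
              (1 + 4 * ε * t) ^ (-((1 - γ) / (2 - γ))) *
                Real.exp (-4 * ε * (y ^ (2 - γ) + A * b * (2 - γ) ^ 2 * t ^ 2)
                    / (b * (2 - γ) ^ 2 * (1 + 4 * ε * t))) *
                Real.exp (1 / (2 * b) *
                  (F (y * (1 + 4 * ε * t) ^ (-(2 / (2 - γ)))) - F y)) *
                u₀ (y * (1 + 4 * ε * t) ^ (-(2 / (2 - γ))))) x := by
  intro ε x t hx ht hs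
  have hk : (2 - γ) ≠ 0 := fun h => hγ (by linarith)
  have hb0 : b ≠ 0 := hb.ne'
  obtain ⟨H, hHdef⟩ : ∃ H : ℝ → ℝ, H = fun y => y ^ (1 - γ) * f y := ⟨_, rfl⟩
  have hHd : ∀ y : ℝ, 0 < y → HasDerivAt H (deriv H y) y := by
    intro y hy
    have h1 : DifferentiableAt ℝ f y :=
      (hf.differentiableOn (by norm_num)).differentiableAt (Ioi_mem_nhds hy)
    have h2 : DifferentiableAt ℝ (fun y : ℝ => y ^ (1 - γ)) y :=
      (Real.hasDerivAt_rpow_const (Or.inl hy.ne')).differentiableAt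
    rw [hHdef]
    exact (h2.mul h1).hasDerivAt
  have hric : ∀ y : ℝ, 0 < y → b * y * deriv H y - b * H y + H y ^ 2 / 2
      = 2 * b * A * y ^ (2 - γ) + B := by
    intro y hy
    have := hriccati y hy
    rw [hHdef]; exact this
  have hfH : ∀ y : ℝ, 0 < y → f y = H y * y ^ γ / y := by
    intro y hy
    rw [hHdef]
    have : y ^ (1 - γ) * y ^ γ = y := by
      rw [← Real.rpow_add hy]; simp
    have hy' := hy.ne'
    field_simp
    linear_combination (- f y) * this
  have hFH : ∀ y : ℝ, 0 < y → HasDerivAt F (H y / y) y := by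
    intro y hy
    have h := hF y hy
    rw [hfH y hy] at h
    have h2 : y ^ γ ≠ 0 := (Real.rpow_pos_of_pos hy γ).ne'
    convert h using 1
    rw [div_right_comm, mul_div_cancel_right₀ _ h2]
  have hu1 : ∀ y : ℝ, 0 < y → HasDerivAt u₀ (deriv u₀ y) y := fun y hy =>
    (hu₀_analytic y hy).differentiableAt.hasDerivAt
  have hu2 : ∀ y : ℝ, 0 < y → HasDerivAt (deriv u₀) (-(H y / (b * y)) * deriv u₀ y) y := by
    intro y hy
    have h1 := (hu₀_analytic y hy).deriv.differentiableAt.hasDerivAt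
    have h2 := hstationary y hy
    rw [iteratedDeriv_succ, iteratedDeriv_one, hfH y hy] at h2
    refine h1.congr_deriv ?_
    have h3 : y ^ γ ≠ 0 := (Real.rpow_pos_of_pos hy γ).ne'
    have hy' := hy.ne'
    generalize deriv (deriv u₀) y = w at *
    generalize y ^ γ = Y at *
    have h5 : Y * (b * w + H y / y * deriv u₀ y) = 0 := by
      rw [← h2]; ring
    have h6 := (mul_eq_zero.mp h5).resolve_left h3
    field_simp at h6 ⊢
    linear_combination h6
  clear hstationary hriccati hF hf hu₀_analytic
  have hpow : ∀ y : ℝ, 0 < y →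
      HasDerivAt (fun y : ℝ => y ^ (2 - γ)) ((2 - γ) * y ^ (2 - γ) / y) y := by
    intro y hy
    convert Real.hasDerivAt_rpow_const (p := 2 - γ) (Or.inl hy.ne') using 1
    rw [Real.rpow_sub_one hy.ne']; ring
  have hxγ : x ^ γ = x ^ 2 / x ^ (2 - γ) := by
    rw [Real.rpow_sub hx, Real.rpow_two]
    rw [div_div_cancel₀ (by positivity)]
  -- time derivative
  have hsd : HasDerivAt (fun τ : ℝ => 1 + 4 * ε * τ) (4 * ε) t := by
    simpa using ((hasDerivAt_id t).const_mul (4 * ε)).const_add 1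
  have hspow : ∀ p : ℝ, HasDerivAt (fun τ : ℝ => (1 + 4 * ε * τ) ^ p)
      (4 * ε * p * (1 + 4 * ε * t) ^ p / (1 + 4 * ε * t)) t := by
    intro p
    convert hsd.rpow_const (p := p) (Or.inl hs.ne') using 1
    rw [Real.rpow_sub_one hs.ne']; ring
  have hlam : 0 < (1 + 4 * ε * t) ^ (-(2 / (2 - γ))) := Real.rpow_pos_of_pos hs _
  have hzk : (x * (1 + 4 * ε * t) ^ (-(2 / (2 - γ)))) ^ (2 - γ)
      = x ^ (2 - γ) / (1 + 4 * ε * t) ^ 2 := by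
    rw [Real.mul_rpow hx.le hlam.le, ← Real.rpow_mul hs.le]
    have : -(2 / (2 - γ)) * (2 - γ) = -(2 : ℝ) := by field_simp
    rw [this, Real.rpow_neg hs.le, Real.rpow_two]; rfl
  have hz : 0 < x * (1 + 4 * ε * t) ^ (-(2 / (2 - γ))) := mul_pos hx hlam
  have hzd := (hspow (-(2 / (2 - γ)))).const_mul x
  have hφt : HasDerivAt (fun τ : ℝ => -4 * ε * (x ^ (2 - γ) + A * b * (2 - γ) ^ 2 * τ ^ 2)
                / (b * (2 - γ) ^ 2 * (1 + 4 * ε * τ)))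
      (16 * ε ^ 2 * (x ^ (2 - γ) + A * b * (2 - γ) ^ 2 * t ^ 2)
        / (b * (2 - γ) ^ 2 * (1 + 4 * ε * t) ^ 2) - 8 * ε * A * t / (1 + 4 * ε * t)) t := by
    have h1 := (((((hasDerivAt_id t).pow 2).const_mul (A * b * (2 - γ) ^ 2)).const_add
      (x ^ (2 - γ))).const_mul (-4 * ε)).div (hsd.const_mul (b * (2 - γ) ^ 2)) (by positivity)
    refine h1.congr_deriv ?_
    have hs' := hs.ne'
    simp
    field_simp
    ring
  have hψt := (((hFH _ hz).comp t hzd).sub_const (F x)).const_mul (1 / (2 * b))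
  have hT := (((hspow (-((1 - γ) / (2 - γ)))).mul hφt.exp).mul hψt.exp).mul ((hu1 _ hz).comp t hzd)
  refine Eq.trans (HasDerivAt.deriv hT) ?_
  -- space derivative
  clear hT hψt hφt hzd hspow hsd
  have hx' := hx.ne'
  have hs' := hs.ne'
  have hl' := hlam.ne'
  have hX : x ^ (2 - γ) ≠ 0 := (Real.rpow_pos_of_pos hx _).ne'
  obtain ⟨C, hC⟩ : ∃ C, C = (1 + 4 * ε * t) ^ (-((1 - γ) / (2 - γ))) := ⟨_, rfl⟩
  simp only [Function.comp_apply, Pi.mul_apply]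
  rw [hfH x hx]
  have hR1 := hric _ hx
  have hR2 := hric _ hz
  rw [hzk] at hR2
  obtain ⟨l, hl⟩ : ∃ l, l = (1 + 4 * ε * t) ^ (-(2 / (2 - γ))) := ⟨_, rfl⟩
  rw [← hl] at hlam hz hl' hR2
  simp only [← hC, ← hl]
  obtain ⟨E, hE⟩ : ∃ E : ℝ → ℝ, E = fun y => C *
              Real.exp (-4 * ε * (y ^ (2 - γ) + A * b * (2 - γ) ^ 2 * t ^ 2)
                  / (b * (2 - γ) ^ 2 * (1 + 4 * ε * t))) *
              Real.exp (1 / (2 * b) * (F (y * l) - F y)) := ⟨_, rfl⟩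
  obtain ⟨P, hP⟩ : ∃ P : ℝ → ℝ, P = fun y =>
    -(4 * ε / (b * (2 - γ) * (1 + 4 * ε * t))) * y ^ (2 - γ) + (H (y * l) - H y) / (2 * b) :=
    ⟨_, rfl⟩
  have hyl : ∀ y : ℝ, HasDerivAt (fun y : ℝ => y * l) l y := fun y => hasDerivAt_mul_const l
  have hEd : ∀ y : ℝ, 0 < y → HasDerivAt E (E y * P y / y) y := by
    intro y hy
    have hy' := hy.ne'
    have h1 := ((((hpow y hy).add_const (A * b * (2 - γ) ^ 2 * t ^ 2)).const_mul
      (-4 * ε)).div_const (b * (2 - γ) ^ 2 * (1 + 4 * ε * t))).exp.const_mul C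
    have h2 := (((((hFH _ (mul_pos hy hlam)).comp y (hyl y)).sub (hFH y hy))).const_mul
      (1 / (2 * b))).exp
    have h3 := h1.mul h2
    rw [hE]
    refine h3.congr_deriv ?_
    simp only [hP, Function.comp_apply, Pi.sub_apply]
    field_simp
  have hPd : ∀ y : ℝ, 0 < y → HasDerivAt P
     (-(4 * ε / (b * (2 - γ) * (1 + 4 * ε * t))) * ((2 - γ) * y ^ (2 - γ) / y)
       + (deriv H (y * l) * l - deriv H y) / (2 * b)) y := by
    intro y hy
    rw [hP]
    exact ((hpow y hy).const_mul _).add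
      ((((hHd _ (mul_pos hy hlam)).comp y (hyl y)).sub (hHd y hy)).div_const _)
  have hU1 : ∀ y : ℝ, 0 < y → HasDerivAt (fun y => E y * u₀ (y * l))
      (E y * P y / y * u₀ (y * l) + E y * (deriv u₀ (y * l) * l)) y := fun y hy =>
    (hEd y hy).mul ((hu1 _ (mul_pos hy hlam)).comp y (hyl y))
  have hU2 := ((((hEd x hx).mul (hPd x hx)).div (hasDerivAt_id x) hx').mul
    ((hu1 _ hz).comp x (hyl x))).add
    ((hEd x hx).mul (((hu2 _ hz).comp x (hyl x)).mul_const l))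
  have hfun : (fun y => C *
              Real.exp (-4 * ε * (y ^ (2 - γ) + A * b * (2 - γ) ^ 2 * t ^ 2)
                  / (b * (2 - γ) ^ 2 * (1 + 4 * ε * t))) *
              Real.exp (1 / (2 * b) * (F (y * l) - F y)) * u₀ (y * l))
      = fun y => E y * u₀ (y * l) := by rw [hE]
  have hev : deriv (fun y => E y * u₀ (y * l)) =ᶠ[nhds x]
      fun y => E y * P y / y * u₀ (y * l) + E y * (deriv u₀ (y * l) * l) := by
    filter_upwards [Ioi_mem_nhds hx] with y hy
    exact (hU1 y hy).deriv
  rw [hfun, iteratedDeriv_succ, iteratedDeriv_one, hev.deriv_eq, (hU1 x hx).deriv,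
    HasDerivAt.deriv (f := fun y => E y * P y / y * u₀ (y * l) + E y * (deriv u₀ (y * l) * l)) hU2,
    hxγ]
  have hEx : E x = C *
              Real.exp (-4 * ε * (x ^ (2 - γ) + A * b * (2 - γ) ^ 2 * t ^ 2)
                  / (b * (2 - γ) ^ 2 * (1 + 4 * ε * t))) *
              Real.exp (1 / (2 * b) * (F (x * l) - F x)) := by rw [hE]
  have hPx : P x = -(4 * ε / (b * (2 - γ) * (1 + 4 * ε * t))) * x ^ (2 - γ)
      + (H (x * l) - H x) / (2 * b) := by rw [hP]
  simp only [Function.comp_apply, Pi.mul_apply, Pi.div_apply, id, hPx, hEx]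
  generalize Real.exp (-4 * ε * (x ^ (2 - γ) + A * b * (2 - γ) ^ 2 * t ^ 2)
                  / (b * (2 - γ) ^ 2 * (1 + 4 * ε * t))) = e1
  generalize Real.exp (1 / (2 * b) * (F (x * l) - F x)) = e2
  clear hU2 hev hfun hU1 hEx hPx hPd hEd hyl hE hP hl hC hfH hFH hu1 hu2 hpow hxγ hHd hHdef hric hzk
  have e3 : deriv H x = (2 * b * A * x ^ (2 - γ) + B + b * H x - H x ^ 2 / 2) / (b * x) := by
    field_simp; linarith
  have e4 : deriv H (x * l) = (2 * b * A * (x ^ (2 - γ) / (1 + 4 * ε * t) ^ 2) + B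
      + b * H (x * l) - H (x * l) ^ 2 / 2) / (b * (x * l)) := by
    rw [eq_div_iff (by positivity)]; linarith
  rw [e3, e4]
  generalize u₀ (x * l) = v0
  generalize deriv u₀ (x * l) = v1
  generalize H (x * l) = Hz
  generalize H x = Hx
  generalize hXX : x ^ (2 - γ) = X at *
  obtain ⟨k, hkk⟩ : ∃ k, k = 2 - γ := ⟨_, rfl⟩
  have hγk : 1 - γ = k - 1 := by linarith
  rw [hγk]
  rw [← hkk] at hk ⊢
  obtain ⟨s, hss⟩ : ∃ s, s = 1 + 4 * ε * t := ⟨_, rfl⟩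
  rw [← hss] at hs' ⊢
  clear hR1 hR2 e3 e4
  field_simp
  rw [hss]
  ring
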